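/- Symmetric form of the generalized Schumacher–Westmoreland–Wootters inequality (eq. (3.34)): I_c ≤ χ{p, ρ} + χ{P_f, ρ_f} − χ{p(·,·), ρ_f^•}, where χ{P_f, ρ_f} := Σ_{ω : P_f(ω) > 0} P_f(ω)·S(ρ_f(ω)|η_f) and χ{p(·,·), ρ_f^•} := Σ_{(α,ω) : p(α,ω) > 0} p(α,ω)·S(ρ_f^α(ω)|η_f) (the χ-quantities of the final ensemble of a posteriori states and of the joint ensemble; both have barycenter η_f). -/

import Mathlib

open Matrix BigOperators
open scoped Kronecker ComplexOrder

noncomputable section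

/-- A density matrix: positive semidefinite with unit trace. -/
def IsDensityMatrix {ι : Type*} [Fintype ι] (ρ : Matrix ι ι ℂ) : Prop :=
  ρ.PosSemidef ∧ ρ.trace = 1

/-- von Neumann entropy (natural logarithm), via the eigenvalues;
junk value `0` if the matrix is not Hermitian. -/
noncomputable def vnEntropy {ι : Type*} [Fintype ι] [DecidableEq ι]
    (ρ : Matrix ι ι ℂ) : ℝ :=
  if h : ρ.IsHermitian then -∑ i, h.eigenvalues i * Real.log (h.eigenvalues i) else 0

/-- Quantum relative entropy `S(σ|τ)` (natural logarithm), computed in an orthonormal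
eigenbasis of `τ`; junk value `0` if `σ` or `τ` is not Hermitian. -/
noncomputable def relEnt {ι : Type*} [Fintype ι] [DecidableEq ι]
    (σ τ : Matrix ι ι ℂ) : ℝ :=
  if h : σ.IsHermitian ∧ τ.IsHermitian then
    (∑ i, h.1.eigenvalues i * Real.log (h.1.eigenvalues i))
      - ∑ j, (if 0 < h.2.eigenvalues j then
          Real.log (h.2.eigenvalues j) *
            ((star (fun i => h.2.eigenvectorBasis j i)) ⬝ᵥ
              σ.mulVec (fun i => h.2.eigenvectorBasis j i)).re
        else 0)
  else 0

/-- Holevo χ-quantity of an ensemble of states, relative to its barycenter. -/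
noncomputable def holevoChi {ι B : Type*} [Fintype ι] [DecidableEq ι] [Fintype B]
    (q : B → ℝ) (τ : B → Matrix ι ι ℂ) : ℝ :=
  ∑ β, if 0 < q β then q β * relEnt (τ β) (∑ γ, q γ • τ γ) else 0

/-- The action of an instrument in Kraus form: `I_ω(ρ) = ∑ k, V ω k * ρ * (V ω k)ᴴ`. -/
noncomputable def instAct {n m : ℕ} {Ω K : Type*} [Fintype K]
    (V : Ω → K → Matrix (Fin m) (Fin n) ℂ) (ω : Ω)
    (ρ : Matrix (Fin n) (Fin n) ℂ) : Matrix (Fin m) (Fin m) ℂ :=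
  ∑ k, V ω k * ρ * (V ω k)ᴴ

/-- The POVM associated with an instrument in Kraus form: `E_ω = ∑ k, (V ω k)ᴴ * V ω k`. -/
noncomputable def povm {n m : ℕ} {Ω K : Type*} [Fintype K]
    (V : Ω → K → Matrix (Fin m) (Fin n) ℂ) (ω : Ω) : Matrix (Fin n) (Fin n) ℂ :=
  ∑ k, (V ω k)ᴴ * V ω k

/-- Outcome probability `Tr(E_ω ρ)`. -/
noncomputable def probOut {n m : ℕ} {Ω K : Type*} [Fintype K]
    (V : Ω → K → Matrix (Fin m) (Fin n) ℂ) (ρ : Matrix (Fin n) (Fin n) ℂ) (ω : Ω) : ℝ :=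
  ((povm V ω * ρ).trace).re

/-- The a posteriori state `π_ρ(ω) = I_ω(ρ)/Tr(I_ω(ρ))` (junk if the trace vanishes). -/
noncomputable def post {n m : ℕ} {Ω K : Type*} [Fintype K]
    (V : Ω → K → Matrix (Fin m) (Fin n) ℂ) (ω : Ω)
    (ρ : Matrix (Fin n) (Fin n) ℂ) : Matrix (Fin m) (Fin m) ℂ :=
  (((instAct V ω ρ).trace.re)⁻¹ : ℝ) • instAct V ω ρ

/-- The classical (Shannon) input/output mutual information of the ensemble `(p, ρ)`
measured with the POVM of the instrument `V`. -/
noncomputable def Ic {n m : ℕ} {A Ω K : Type*} [Fintype A] [Fintype Ω] [Fintype K]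
    (p : A → ℝ) (ρ : A → Matrix (Fin n) (Fin n) ℂ)
    (V : Ω → K → Matrix (Fin m) (Fin n) ℂ) : ℝ :=
  ∑ α, ∑ ω,
    if 0 < p α * probOut V (ρ α) ω then
      p α * probOut V (ρ α) ω *
        Real.log ((p α * probOut V (ρ α) ω) /
          (p α * probOut V (∑ β, p β • ρ β) ω))
    else 0

/-- Quantum information gain of the instrument `V` at the state `ρ`. -/
noncomputable def infoGain {n m : ℕ} {Ω K : Type*} [Fintype Ω] [Fintype K]
    (V : Ω → K → Matrix (Fin m) (Fin n) ℂ) (ρ : Matrix (Fin n) (Fin n) ℂ) : ℝ :=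
  vnEntropy ρ - ∑ ω, if 0 < (instAct V ω ρ).trace.re then
    (instAct V ω ρ).trace.re * vnEntropy (post V ω ρ) else 0


/-- The concave quadratic functional of `Y` whose supremum is the resolvent form of the relative
modular operator of `(σ, τ)` at `R`. -/
def modularQuad {ι : Type*} [Fintype ι] (σ τ : Matrix ι ι ℂ) (R : ℝ) (Y : Matrix ι ι ℂ) : ℝ :=
  2 * (Y * σ).trace.re - R * (σ * (Yᴴ * Y)).trace.re - (τ * (Y * Yᴴ)).trace.re

/-- The squared overlaps of the eigenbases of two Hermitian matrices. -/
def overlap {ι : Type*} [Fintype ι] [DecidableEq ι] {σ τ : Matrix ι ι ℂ}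
    (hσ : σ.IsHermitian) (hτ : τ.IsHermitian) (i j : ι) : ℝ :=
  Complex.normSq (((hσ.eigenvectorUnitary : Matrix ι ι ℂ)ᴴ * hτ.eigenvectorUnitary) i j)

/-- The resolvent form of the relative modular operator, in the eigenbases. -/
def modularResolvent {ι : Type*} [Fintype ι] [DecidableEq ι] {σ τ : Matrix ι ι ℂ}
    (hσ : σ.IsHermitian) (hτ : τ.IsHermitian) (R : ℝ) : ℝ :=
  ∑ i, ∑ j, overlap hσ hτ i j *
    (hσ.eigenvalues i ^ 2 / (hτ.eigenvalues j + R * hσ.eigenvalues i))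

/-- The linear functional `σ ↦ Tr (σ log τ)`, computed in an eigenbasis of `τ`. -/
def traceMulLog {ι : Type*} [Fintype ι] [DecidableEq ι] {τ : Matrix ι ι ℂ}
    (hτ : τ.IsHermitian) (σ : Matrix ι ι ℂ) : ℝ :=
  ∑ j, Real.log (hτ.eigenvalues j) *
    (((hτ.eigenvectorUnitary : Matrix ι ι ℂ)ᴴ * σ * hτ.eigenvectorUnitary) j j).re

open scoped MatrixOrder in
lemma trace_mul_nonneg {ι : Type*} [Fintype ι] {X Y : Matrix ι ι ℂ}
    (hX : X.PosSemidef) (hY : Y.PosSemidef) : 0 ≤ (X * Y).trace := by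
  classical
  obtain ⟨C, rfl⟩ := CStarAlgebra.nonneg_iff_eq_star_mul_self.mp hX.nonneg
  rw [Matrix.mul_assoc, Matrix.trace_mul_comm]
  exact (hY.mul_mul_conjTranspose_same C).trace_nonneg

section Spectral

variable {ι : Type*} [Fintype ι] [DecidableEq ι] {σ τ : Matrix ι ι ℂ}

lemma eigenvectorUnitary_conjTranspose_mul (hσ : σ.IsHermitian) :
    (hσ.eigenvectorUnitary : Matrix ι ι ℂ)ᴴ * hσ.eigenvectorUnitary = 1 :=
  Unitary.coe_star_mul_self hσ.eigenvectorUnitary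

lemma eigenvectorUnitary_mul_conjTranspose (hσ : σ.IsHermitian) :
    (hσ.eigenvectorUnitary : Matrix ι ι ℂ) * (hσ.eigenvectorUnitary : Matrix ι ι ℂ)ᴴ = 1 :=
  Unitary.coe_mul_star_self hσ.eigenvectorUnitary

lemma spectral_decomposition (hσ : σ.IsHermitian) :
    σ = hσ.eigenvectorUnitary * diagonal (fun i => (hσ.eigenvalues i : ℂ)) *
      (hσ.eigenvectorUnitary : Matrix ι ι ℂ)ᴴ := by
  have h := hσ.spectral_theorem
  rw [Unitary.conjStarAlgAut_apply] at h
  exact h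

lemma overlap_nonneg (hσ : σ.IsHermitian) (hτ : τ.IsHermitian) (i j : ι) :
    0 ≤ overlap hσ hτ i j := Complex.normSq_nonneg _

lemma sum_normSq_row {U : Matrix ι ι ℂ} (hU : U * Uᴴ = 1) (i : ι) :
    ∑ j, Complex.normSq (U i j) = 1 := by
  have h := congrArg Complex.re (congrFun (congrFun hU i) i)
  simpa [Matrix.mul_apply, Complex.mul_conj] using h

lemma sum_overlap (hσ : σ.IsHermitian) (hτ : τ.IsHermitian) (i : ι) :
    ∑ j, overlap hσ hτ i j = 1 := by
  refine sum_normSq_row ?_ i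
  rw [conjTranspose_mul, conjTranspose_conjTranspose, Matrix.mul_assoc,
    ← Matrix.mul_assoc (hτ.eigenvectorUnitary : Matrix ι ι ℂ),
    eigenvectorUnitary_mul_conjTranspose, Matrix.one_mul, eigenvectorUnitary_conjTranspose_mul]

lemma re_trace_eq_sum_eigenvalues (hσ : σ.IsHermitian) :
    σ.trace.re = ∑ i, hσ.eigenvalues i := by
  simp [hσ.trace_eq_sum_eigenvalues]

lemma modularQuad_diagonal {A B : Matrix ι ι ℂ} (hA : Aᴴ * A = 1) (hB : Bᴴ * B = 1)
    (s t : ι → ℝ) (R : ℝ) (Z : Matrix ι ι ℂ) :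
    modularQuad (A * diagonal (fun i => (s i : ℂ)) * Aᴴ)
      (B * diagonal (fun i => (t i : ℂ)) * Bᴴ) R (B * Z * Aᴴ) =
    ∑ i, ∑ j, (2 * s i * ((Aᴴ * B) i j * Z j i).re
      - (t j + R * s i) * Complex.normSq (Z j i)) := by
  set S : Matrix ι ι ℂ := diagonal (fun i => (s i : ℂ)) with hS
  set T : Matrix ι ι ℂ := diagonal (fun i => (t i : ℂ)) with hT
  have hA' : ∀ X : Matrix ι ι ℂ, Aᴴ * (A * X) = X := fun X => by
    rw [← Matrix.mul_assoc, hA, Matrix.one_mul]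
  have hB' : ∀ X : Matrix ι ι ℂ, Bᴴ * (B * X) = X := fun X => by
    rw [← Matrix.mul_assoc, hB, Matrix.one_mul]
  have e1 : (B * Z * Aᴴ * (A * S * Aᴴ)).trace = (S * ((Aᴴ * B) * Z)).trace := by
    simp only [Matrix.mul_assoc, hA']
    rw [← Matrix.mul_assoc B, Matrix.trace_mul_comm]
    simp only [Matrix.mul_assoc]
  have e2 : (A * S * Aᴴ * ((B * Z * Aᴴ)ᴴ * (B * Z * Aᴴ))).trace = (S * (Zᴴ * Z)).trace := by
    simp only [conjTranspose_mul, conjTranspose_conjTranspose, Matrix.mul_assoc, hA', hB']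
    rw [Matrix.trace_mul_comm]
    simp only [Matrix.mul_assoc, hA, Matrix.mul_one]
  have e3 : (B * T * Bᴴ * ((B * Z * Aᴴ) * (B * Z * Aᴴ)ᴴ)).trace = (T * (Z * Zᴴ)).trace := by
    simp only [conjTranspose_mul, conjTranspose_conjTranspose, Matrix.mul_assoc, hA', hB']
    rw [Matrix.trace_mul_comm]
    simp only [Matrix.mul_assoc, hB, Matrix.mul_one]
  rw [modularQuad, e1, e2, e3]
  have f1 : (S * ((Aᴴ * B) * Z)).trace.re = ∑ i, ∑ j, s i * ((Aᴴ * B) i j * Z j i).re := by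
    rw [Matrix.trace, Complex.re_sum]
    refine Finset.sum_congr rfl fun i _ => ?_
    rw [Matrix.diag_apply, hS, Matrix.diagonal_mul, Matrix.mul_apply, Complex.re_ofReal_mul,
      Complex.re_sum, Finset.mul_sum]
  have f2 : (S * (Zᴴ * Z)).trace.re = ∑ i, ∑ j, s i * Complex.normSq (Z j i) := by
    rw [Matrix.trace, Complex.re_sum]
    refine Finset.sum_congr rfl fun i _ => ?_
    rw [Matrix.diag_apply, hS, Matrix.diagonal_mul, Matrix.mul_apply, Complex.re_ofReal_mul,
      Complex.re_sum, Finset.mul_sum]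
    refine Finset.sum_congr rfl fun j _ => ?_
    simp [Complex.normSq_apply]
  have f3 : (T * (Z * Zᴴ)).trace.re = ∑ i, ∑ j, t j * Complex.normSq (Z j i) := by
    rw [Finset.sum_comm, Matrix.trace, Complex.re_sum]
    refine Finset.sum_congr rfl fun i _ => ?_
    rw [Matrix.diag_apply, hT, Matrix.diagonal_mul, Matrix.mul_apply, Complex.re_ofReal_mul,
      Complex.re_sum, Finset.mul_sum]
    refine Finset.sum_congr rfl fun j _ => ?_
    simp [Complex.normSq_apply]
  rw [f1, f2, f3]
  simp only [Finset.mul_sum, ← Finset.sum_sub_distrib]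
  refine Finset.sum_congr rfl fun i _ => Finset.sum_congr rfl fun j _ => ?_
  ring

lemma modularQuad_eigenbasis (hσ : σ.IsHermitian) (hτ : τ.IsHermitian) (R : ℝ)
    (Z : Matrix ι ι ℂ) :
    modularQuad σ τ R (hτ.eigenvectorUnitary * Z * (hσ.eigenvectorUnitary : Matrix ι ι ℂ)ᴴ) =
    ∑ i, ∑ j, (2 * hσ.eigenvalues i *
        (((hσ.eigenvectorUnitary : Matrix ι ι ℂ)ᴴ * hτ.eigenvectorUnitary) i j * Z j i).re
      - (hτ.eigenvalues j + R * hσ.eigenvalues i) * Complex.normSq (Z j i)) := by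
  have h := modularQuad_diagonal (eigenvectorUnitary_conjTranspose_mul hσ)
    (eigenvectorUnitary_conjTranspose_mul hτ) hσ.eigenvalues hτ.eigenvalues R Z
  rwa [← spectral_decomposition hσ, ← spectral_decomposition hτ] at h

lemma two_mul_re_sub_le {s t R : ℝ} (hs : 0 ≤ s) (ht : 0 ≤ t) (hR : 0 < R) (u z : ℂ) :
    2 * s * (u * z).re - (t + R * s) * Complex.normSq z ≤
      Complex.normSq u * (s ^ 2 / (t + R * s)) := by
  rcases hs.eq_or_lt with rfl | hs
  · have := mul_nonneg ht (Complex.normSq_nonneg z)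
    simpa using this
  · have hd : 0 < t + R * s := by positivity
    rw [mul_div_assoc', le_div_iff₀ hd]
    simp only [Complex.normSq_apply, Complex.mul_re]
    nlinarith [sq_nonneg ((t + R * s) * z.re - s * u.re),
      sq_nonneg ((t + R * s) * z.im + s * u.im)]

lemma modularQuad_le_modularResolvent (hσ : σ.PosSemidef) (hτ : τ.PosSemidef) {R : ℝ}
    (hR : 0 < R) (Y : Matrix ι ι ℂ) :
    modularQuad σ τ R Y ≤ modularResolvent hσ.1 hτ.1 R := by
  have hY : Y = hτ.1.eigenvectorUnitary *
      ((hτ.1.eigenvectorUnitary : Matrix ι ι ℂ)ᴴ * Y * hσ.1.eigenvectorUnitary) *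
      (hσ.1.eigenvectorUnitary : Matrix ι ι ℂ)ᴴ := by
    simp only [Matrix.mul_assoc, eigenvectorUnitary_mul_conjTranspose, Matrix.mul_one]
    rw [← Matrix.mul_assoc, eigenvectorUnitary_mul_conjTranspose, Matrix.one_mul]
  rw [hY, modularQuad_eigenbasis, modularResolvent]
  exact Finset.sum_le_sum fun i _ => Finset.sum_le_sum fun j _ =>
    two_mul_re_sub_le (hσ.eigenvalues_nonneg i) (hτ.eigenvalues_nonneg j) hR _ _

lemma exists_modularQuad_eq_modularResolvent (hσ : σ.PosSemidef) (hτ : τ.PosSemidef) {R : ℝ}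
    (hR : 0 < R) : ∃ Y, modularQuad σ τ R Y = modularResolvent hσ.1 hτ.1 R := by
  refine ⟨hτ.1.eigenvectorUnitary * (Matrix.of fun j i =>
    ((hσ.1.eigenvalues i / (hτ.1.eigenvalues j + R * hσ.1.eigenvalues i) : ℝ) : ℂ) *
      star (((hσ.1.eigenvectorUnitary : Matrix ι ι ℂ)ᴴ * hτ.1.eigenvectorUnitary) i j)) *
    (hσ.1.eigenvectorUnitary : Matrix ι ι ℂ)ᴴ, ?_⟩
  rw [modularQuad_eigenbasis, modularResolvent]
  refine Finset.sum_congr rfl fun i _ => Finset.sum_congr rfl fun j _ => ?_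
  simp only [Matrix.of_apply, overlap]
  generalize ((hσ.1.eigenvectorUnitary : Matrix ι ι ℂ)ᴴ * hτ.1.eigenvectorUnitary) i j = u
  have hs := hσ.eigenvalues_nonneg i
  have ht := hτ.eigenvalues_nonneg j
  generalize hσ.1.eigenvalues i = s at *
  generalize hτ.1.eigenvalues j = t at *
  rcases hs.eq_or_lt with rfl | hs
  · simp
  · have hd : t + R * s ≠ 0 := by positivity
    have h1 : (u * (((s / (t + R * s) : ℝ) : ℂ) * star u)).re =
        s / (t + R * s) * Complex.normSq u := by
      rw [mul_left_comm, Complex.re_ofReal_mul, Complex.star_def, Complex.mul_conj,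
        Complex.ofReal_re]
    rw [h1, map_mul, Complex.normSq_ofReal, Complex.star_def, Complex.normSq_conj]
    field_simp
    ring

lemma re_conj_eigenbasis_apply (hσ : σ.IsHermitian) (hτ : τ.IsHermitian) (j : ι) :
    (((hτ.eigenvectorUnitary : Matrix ι ι ℂ)ᴴ * σ * hτ.eigenvectorUnitary) j j).re =
      ∑ i, overlap hσ hτ i j * hσ.eigenvalues i := by
  have h : (hτ.eigenvectorUnitary : Matrix ι ι ℂ)ᴴ * σ * hτ.eigenvectorUnitary =
      ((hσ.eigenvectorUnitary : Matrix ι ι ℂ)ᴴ * (hτ.eigenvectorUnitary : Matrix ι ι ℂ))ᴴ *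
        (diagonal (fun i => (hσ.eigenvalues i : ℂ)) *
          ((hσ.eigenvectorUnitary : Matrix ι ι ℂ)ᴴ * (hτ.eigenvectorUnitary : Matrix ι ι ℂ))) := by
    have hs := congrArg (fun X => (hτ.eigenvectorUnitary : Matrix ι ι ℂ)ᴴ * X *
      (hτ.eigenvectorUnitary : Matrix ι ι ℂ)) (spectral_decomposition hσ)
    refine hs.trans ?_
    simp only [conjTranspose_mul, conjTranspose_conjTranspose, Matrix.mul_assoc]
  rw [h, Matrix.mul_apply, Complex.re_sum]
  refine Finset.sum_congr rfl fun i _ => ?_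
  rw [Matrix.diagonal_mul, Matrix.conjTranspose_apply, mul_left_comm, Complex.re_ofReal_mul,
    Complex.star_def, ← Complex.normSq_eq_conj_mul_self, Complex.ofReal_re, overlap, mul_comm]

lemma re_conj_eigenbasis_apply_self (hτ : τ.IsHermitian) (j : ι) :
    (((hτ.eigenvectorUnitary : Matrix ι ι ℂ)ᴴ * τ * hτ.eigenvectorUnitary) j j).re =
      hτ.eigenvalues j := by
  rw [re_conj_eigenbasis_apply hτ hτ]
  simp [overlap, eigenvectorUnitary_conjTranspose_mul, Matrix.one_apply, apply_ite Complex.normSq]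

lemma eigenvalues_pos_of_overlap_ne_zero (hσ : σ.PosSemidef) (hτ : τ.PosSemidef) {c : ℝ}
    (hc : 0 < c) (h : (τ - c • σ).PosSemidef) {i j : ι}
    (hij : overlap hσ.1 hτ.1 i j * hσ.1.eigenvalues i ≠ 0) : 0 < hτ.1.eigenvalues j := by
  have h1 := (h.conjTranspose_mul_mul_same (hτ.1.eigenvectorUnitary : Matrix ι ι ℂ)).diag_nonneg
    (i := j)
  have h2 := (Complex.le_def.1 h1).1
  rw [Matrix.mul_sub, Matrix.sub_mul, Matrix.sub_apply, Complex.sub_re,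
    re_conj_eigenbasis_apply_self, Matrix.mul_smul, Matrix.smul_mul, Matrix.smul_apply,
    Complex.smul_re, re_conj_eigenbasis_apply hσ.1 hτ.1] at h2
  have hnn : ∀ k, 0 ≤ overlap hσ.1 hτ.1 k j * hσ.1.eigenvalues k := fun k =>
    mul_nonneg (overlap_nonneg _ _ _ _) (hσ.eigenvalues_nonneg k)
  have h3 := Finset.single_le_sum (fun k _ => hnn k) (Finset.mem_univ i)
  have h4 := mul_pos hc ((lt_of_le_of_ne (hnn i) hij.symm).trans_le h3)
  simp only [Complex.zero_re, smul_eq_mul] at h2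
  linarith

lemma relEnt_eq_neg_vnEntropy_sub (hσ : σ.IsHermitian) (hτ : τ.PosSemidef) :
    relEnt σ τ = -vnEntropy σ - traceMulLog hτ.1 σ := by
  rw [relEnt, dif_pos ⟨hσ, hτ.1⟩, vnEntropy, dif_pos hσ, neg_neg, traceMulLog]
  congr 1
  refine Finset.sum_congr rfl fun j _ => ?_
  have hj : (star (fun i => hτ.1.eigenvectorBasis j i)) ⬝ᵥ
      σ.mulVec (fun i => hτ.1.eigenvectorBasis j i) =
      ((hτ.1.eigenvectorUnitary : Matrix ι ι ℂ)ᴴ * σ * hτ.1.eigenvectorUnitary) j j := by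
    rw [Matrix.mul_assoc, Matrix.mul_apply]
    rfl
  rw [hj]
  split_ifs with h
  · rfl
  · have : hτ.1.eigenvalues j = 0 := le_antisymm (not_lt.1 h) (hτ.eigenvalues_nonneg j)
    simp [this]

lemma relEnt_eq_sum_overlap (hσ : σ.IsHermitian) (hτ : τ.PosSemidef) :
    relEnt σ τ = ∑ i, ∑ j, overlap hσ hτ.1 i j * hσ.eigenvalues i *
      (Real.log (hσ.eigenvalues i) - Real.log (hτ.1.eigenvalues j)) := by
  rw [relEnt_eq_neg_vnEntropy_sub hσ hτ, vnEntropy, dif_pos hσ, neg_neg, traceMulLog]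
  simp only [re_conj_eigenbasis_apply hσ hτ.1, mul_sub, Finset.sum_sub_distrib]
  congr 1
  · refine Finset.sum_congr rfl fun i _ => ?_
    rw [← Finset.sum_mul, ← Finset.sum_mul, sum_overlap, one_mul]
  · rw [Finset.sum_comm]
    refine Finset.sum_congr rfl fun j _ => ?_
    rw [Finset.mul_sum]
    exact Finset.sum_congr rfl fun i _ => by ring

lemma traceMulLog_add (hτ : τ.IsHermitian) (X Y : Matrix ι ι ℂ) :
    traceMulLog hτ (X + Y) = traceMulLog hτ X + traceMulLog hτ Y := by
  simp [traceMulLog, Matrix.add_mul, mul_add, Finset.sum_add_distrib]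

lemma traceMulLog_smul (hτ : τ.IsHermitian) (c : ℝ) (X : Matrix ι ι ℂ) :
    traceMulLog hτ (c • X) = c * traceMulLog hτ X := by
  simp [traceMulLog, Finset.mul_sum, mul_left_comm]

lemma traceMulLog_sum_smul {B : Type*} (hτ : τ.IsHermitian) (u : Finset B) (c : B → ℝ)
    (X : B → Matrix ι ι ℂ) :
    traceMulLog hτ (∑ b ∈ u, c b • X b) = ∑ b ∈ u, c b * traceMulLog hτ (X b) := by
  classical
  induction u using Finset.induction_on with
  | empty => simp [traceMulLog]
  | insert a u ha ih =>
    rw [Finset.sum_insert ha, Finset.sum_insert ha, traceMulLog_add, traceMulLog_smul, ih]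

lemma traceMulLog_self (hτ : τ.IsHermitian) : traceMulLog hτ τ = -vnEntropy τ := by
  rw [vnEntropy, dif_pos hτ, neg_neg, traceMulLog]
  simp only [re_conj_eigenbasis_apply_self, mul_comm]

lemma re_trace_cfc (hσ : σ.IsHermitian) (f : ℝ → ℝ) :
    (cfc f σ).trace.re = ∑ i, f (hσ.eigenvalues i) := by
  rw [hσ.cfc_eq, IsHermitian.cfc, Unitary.conjStarAlgAut_apply, Matrix.trace_mul_cycle,
    Unitary.coe_star_mul_self, Matrix.one_mul]
  simp [Matrix.trace]

lemma vnEntropy_eq_sum_negMulLog (hσ : σ.IsHermitian) :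
    vnEntropy σ = ∑ i, Real.negMulLog (hσ.eigenvalues i) := by
  rw [vnEntropy, dif_pos hσ, ← Finset.sum_neg_distrib]
  simp [Real.negMulLog]

lemma vnEntropy_smul (hσ : σ.IsHermitian) (c : ℝ) :
    vnEntropy (c • σ) = c * vnEntropy σ + Real.negMulLog c * σ.trace.re := by
  have hcσ : (c • σ).IsHermitian := by
    rw [IsHermitian, conjTranspose_smul, hσ.eq, star_trivial]
  rw [vnEntropy_eq_sum_negMulLog hcσ, ← re_trace_cfc hcσ, ← cfc_comp_smul c Real.negMulLog σ
    Real.continuous_negMulLog.continuousOn hσ.isSelfAdjoint, re_trace_cfc hσ,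
    vnEntropy_eq_sum_negMulLog hσ,
    re_trace_eq_sum_eigenvalues hσ, Finset.mul_sum, Finset.mul_sum, ← Finset.sum_add_distrib]
  refine Finset.sum_congr rfl fun i _ => ?_
  rw [smul_eq_mul, Real.negMulLog_mul]
  ring

/-- The truncated integral over `[0, R]` of the resolvent representation of `relEnt`. -/
def truncRelEnt (hσ : σ.IsHermitian) (hτ : τ.IsHermitian) (R : ℝ) : ℝ :=
  ∑ i, ∑ j, overlap hσ hτ i j * hσ.eigenvalues i *
    (Real.log (hτ.eigenvalues j + R * hσ.eigenvalues i) - Real.log (hτ.eigenvalues j)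
      - Real.log (1 + R))

lemma truncRelEnt_zero (hσ : σ.IsHermitian) (hτ : τ.IsHermitian) :
    truncRelEnt hσ hτ 0 = 0 := by
  simp [truncRelEnt]

lemma hasDerivAt_truncRelEnt (hσ : σ.PosSemidef) (hτ : τ.PosSemidef) {c : ℝ} (hc : 0 < c)
    (h : (τ - c • σ).PosSemidef) {R : ℝ} (hR : 0 ≤ R) :
    HasDerivAt (truncRelEnt hσ.1 hτ.1)
      (modularResolvent hσ.1 hτ.1 R - σ.trace.re / (1 + R)) R := by
  have key : modularResolvent hσ.1 hτ.1 R - σ.trace.re / (1 + R) =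
      ∑ i, ∑ j, overlap hσ.1 hτ.1 i j * hσ.1.eigenvalues i *
        (hσ.1.eigenvalues i / (hτ.1.eigenvalues j + R * hσ.1.eigenvalues i) - 1 / (1 + R)) := by
    rw [re_trace_eq_sum_eigenvalues hσ.1, modularResolvent, Finset.sum_div,
      ← Finset.sum_sub_distrib]
    refine Finset.sum_congr rfl fun i _ => ?_
    simp only [mul_sub, Finset.sum_sub_distrib]
    rw [← Finset.sum_mul, ← Finset.sum_mul, sum_overlap, one_mul, mul_one_div]
    congr 1
    exact Finset.sum_congr rfl fun j _ => by ring
  rw [key]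
  refine HasDerivAt.fun_sum fun i _ => HasDerivAt.fun_sum fun j _ => ?_
  by_cases hij : overlap hσ.1 hτ.1 i j * hσ.1.eigenvalues i = 0
  · simpa [hij] using hasDerivAt_const R (0 : ℝ)
  · have ht := eigenvalues_pos_of_overlap_ne_zero hσ hτ hc h hij
    have hs := hσ.eigenvalues_nonneg i
    refine HasDerivAt.const_mul _ ?_
    have h1 : HasDerivAt (fun x : ℝ => hτ.1.eigenvalues j + x * hσ.1.eigenvalues i)
        (hσ.1.eigenvalues i) R := by
      simpa using ((hasDerivAt_id R).mul_const (hσ.1.eigenvalues i)).const_add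
        (hτ.1.eigenvalues j)
    have h2 : HasDerivAt (fun x : ℝ => 1 + x) 1 R := by
      simpa using (hasDerivAt_id R).const_add 1
    exact ((h1.log (by positivity)).sub_const _).sub (h2.log (by positivity))

open Filter Topology in
lemma tendsto_log_add_mul_sub_log {s t : ℝ} (hs : 0 < s) (ht : 0 < t) :
    Tendsto (fun R : ℝ => Real.log (t + R * s) - Real.log t - Real.log (1 + R)) atTop
      (𝓝 (Real.log s - Real.log t)) := by
  have h1 : Tendsto (fun R : ℝ => s + (t - s) / (1 + R)) atTop (𝓝 (s + 0)) :=
    (tendsto_const_nhds.div_atTop (tendsto_atTop_add_const_left _ 1 tendsto_id)).const_add s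
  rw [add_zero] at h1
  have h2 := (((Real.continuousAt_log hs.ne').tendsto.comp h1).sub_const (Real.log t))
  refine h2.congr' ?_
  filter_upwards [eventually_ge_atTop 0] with R hR
  have h3 : s + (t - s) / (1 + R) = (t + R * s) / (1 + R) := by
    field_simp
    ring
  rw [Function.comp_apply, h3, Real.log_div (by positivity) (by positivity)]
  ring

open Filter Topology in
lemma tendsto_truncRelEnt (hσ : σ.PosSemidef) (hτ : τ.PosSemidef) {c : ℝ} (hc : 0 < c)
    (h : (τ - c • σ).PosSemidef) :
    Tendsto (truncRelEnt hσ.1 hτ.1) atTop (𝓝 (relEnt σ τ)) := by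
  rw [relEnt_eq_sum_overlap hσ.1 hτ]
  refine tendsto_finsetSum _ fun i _ => tendsto_finsetSum _ fun j _ => ?_
  by_cases hij : overlap hσ.1 hτ.1 i j * hσ.1.eigenvalues i = 0
  · simp [hij]
  · exact (tendsto_log_add_mul_sub_log
      (lt_of_le_of_ne (hσ.eigenvalues_nonneg i) (right_ne_zero_of_mul hij).symm)
      (eigenvalues_pos_of_overlap_ne_zero hσ hτ hc h hij)).const_mul _

end Spectral

section Instrument

variable {Ω K : Type*} [Fintype K] {n m : ℕ} (V : Ω → K → Matrix (Fin m) (Fin n) ℂ)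

lemma instAct_sub (ω : Ω) (X Y : Matrix (Fin n) (Fin n) ℂ) :
    instAct V ω (X - Y) = instAct V ω X - instAct V ω Y := by
  simp [instAct, Matrix.mul_sub, Matrix.sub_mul]

lemma instAct_smul (ω : Ω) (c : ℝ) (X : Matrix (Fin n) (Fin n) ℂ) :
    instAct V ω (c • X) = c • instAct V ω X := by
  simp [instAct, Finset.smul_sum]

lemma instAct_sum {B : Type*} (ω : Ω) (u : Finset B) (X : B → Matrix (Fin n) (Fin n) ℂ) :
    instAct V ω (∑ b ∈ u, X b) = ∑ b ∈ u, instAct V ω (X b) := by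
  simp only [instAct, Matrix.mul_sum, Matrix.sum_mul]
  exact Finset.sum_comm

lemma instAct_posSemidef (ω : Ω) {X : Matrix (Fin n) (Fin n) ℂ} (hX : X.PosSemidef) :
    (instAct V ω X).PosSemidef :=
  Matrix.posSemidef_sum _ fun k _ => hX.mul_mul_conjTranspose_same (V ω k)

lemma trace_instAct_mul (ω : Ω) (X : Matrix (Fin n) (Fin n) ℂ) (Z : Matrix (Fin m) (Fin m) ℂ) :
    (instAct V ω X * Z).trace = (X * ∑ k, (V ω k)ᴴ * Z * V ω k).trace := by
  simp only [instAct, Matrix.sum_mul, Matrix.mul_sum, Matrix.trace_sum]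
  refine Finset.sum_congr rfl fun k _ => ?_
  rw [Matrix.mul_assoc, Matrix.mul_assoc, Matrix.trace_mul_comm]
  simp only [Matrix.mul_assoc]

lemma probOut_eq_re_trace_instAct (ω : Ω) (X : Matrix (Fin n) (Fin n) ℂ) :
    probOut V X ω = (instAct V ω X).trace.re := by
  have h := trace_instAct_mul V ω X 1
  rw [Matrix.mul_one] at h
  rw [probOut, povm, Matrix.trace_mul_comm, h]
  simp

lemma probOut_nonneg (ω : Ω) {X : Matrix (Fin n) (Fin n) ℂ} (hX : X.PosSemidef) :
    0 ≤ probOut V X ω := by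
  rw [probOut_eq_re_trace_instAct]
  exact (Complex.le_def.1 (instAct_posSemidef V ω hX).trace_nonneg).1

lemma probOut_sum_smul {B : Type*} (ω : Ω) (u : Finset B) (c : B → ℝ)
    (X : B → Matrix (Fin n) (Fin n) ℂ) :
    probOut V (∑ b ∈ u, c b • X b) ω = ∑ b ∈ u, c b * probOut V (X b) ω := by
  simp [probOut, Matrix.mul_sum, Matrix.trace_sum]

lemma post_posSemidef (ω : Ω) {X : Matrix (Fin n) (Fin n) ℂ} (hX : X.PosSemidef) :
    (post V ω X).PosSemidef := by
  have h := probOut_nonneg V ω hX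
  rw [probOut_eq_re_trace_instAct] at h
  exact (instAct_posSemidef V ω hX).smul (inv_nonneg.2 h)

lemma instAct_eq_zero_of_probOut_eq_zero (ω : Ω) {X : Matrix (Fin n) (Fin n) ℂ}
    (hX : X.PosSemidef) (h : probOut V X ω = 0) : instAct V ω X = 0 := by
  rw [probOut_eq_re_trace_instAct] at h
  have hI := instAct_posSemidef V ω hX
  refine hI.trace_eq_zero_iff.1 (Complex.ext h ?_)
  exact (Complex.le_def.1 hI.trace_nonneg).2.symm

lemma probOut_smul_post (ω : Ω) {X : Matrix (Fin n) (Fin n) ℂ} (hX : X.PosSemidef) :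
    probOut V X ω • post V ω X = instAct V ω X := by
  by_cases h : probOut V X ω = 0
  · rw [h, zero_smul, instAct_eq_zero_of_probOut_eq_zero V ω hX h]
  · rw [post, ← probOut_eq_re_trace_instAct, smul_inv_smul₀ h]

lemma vnEntropy_instAct (ω : Ω) {X : Matrix (Fin n) (Fin n) ℂ} (hX : X.PosSemidef) :
    vnEntropy (instAct V ω X) =
      probOut V X ω * vnEntropy (post V ω X) + Real.negMulLog (probOut V X ω) := by
  rw [← probOut_smul_post V ω hX, vnEntropy_smul (post_posSemidef V ω hX).1]
  by_cases h : probOut V X ω = 0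
  · simp [h]
  · rw [post, Matrix.trace_smul, Complex.smul_re, ← probOut_eq_re_trace_instAct, smul_eq_mul,
      inv_mul_cancel₀ h, mul_one]

lemma probOut_mul_relEnt_post (ω : Ω) {X : Matrix (Fin n) (Fin n) ℂ} (hX : X.PosSemidef)
    {τ : Matrix (Fin m) (Fin m) ℂ} (hτ : τ.PosSemidef) :
    probOut V X ω * relEnt (post V ω X) τ =
      -(probOut V X ω * vnEntropy (post V ω X)) - traceMulLog hτ.1 (instAct V ω X) := by
  rw [relEnt_eq_neg_vnEntropy_sub (post_posSemidef V ω hX).1 hτ,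
    ← probOut_smul_post V ω hX, traceMulLog_smul]
  ring

variable [Fintype Ω]

/-- Kadison–Schwarz inequality for the dual channel of an instrument, traced against a positive
matrix. -/
lemma re_trace_dual_conjTranspose_mul_le (hV : ∑ ω, ∑ k, (V ω k)ᴴ * V ω k = 1)
    {X : Matrix (Fin n) (Fin n) ℂ} (hX : X.PosSemidef) (Z : Ω → Matrix (Fin m) (Fin m) ℂ)
    {Y : Matrix (Fin n) (Fin n) ℂ} (hY : Y = ∑ ω, ∑ k, (V ω k)ᴴ * Z ω * V ω k) :
    (X * (Yᴴ * Y)).trace.re ≤ ∑ ω, (instAct V ω X * ((Z ω)ᴴ * Z ω)).trace.re := by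
  have hYs : Yᴴ = ∑ ω, ∑ k, (V ω k)ᴴ * (Z ω)ᴴ * V ω k := by
    simp [hY, conjTranspose_sum, Matrix.mul_assoc]
  have hsq : ∑ ω, ∑ k, (Z ω * V ω k - V ω k * Y)ᴴ * (Z ω * V ω k - V ω k * Y) =
      (∑ ω, ∑ k, (V ω k)ᴴ * ((Z ω)ᴴ * Z ω) * V ω k) - Yᴴ * Y := by
    have hexp : ∀ ω k, (Z ω * V ω k - V ω k * Y)ᴴ * (Z ω * V ω k - V ω k * Y) =
        (V ω k)ᴴ * ((Z ω)ᴴ * Z ω) * V ω k - ((V ω k)ᴴ * (Z ω)ᴴ * V ω k) * Y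
          - Yᴴ * ((V ω k)ᴴ * Z ω * V ω k) + Yᴴ * ((V ω k)ᴴ * V ω k) * Y := fun ω k => by
      simp only [conjTranspose_sub, conjTranspose_mul, Matrix.sub_mul, Matrix.mul_sub,
        Matrix.mul_assoc]
      abel
    simp only [hexp, Finset.sum_add_distrib, Finset.sum_sub_distrib, ← Matrix.sum_mul,
      ← Matrix.mul_sum]
    rw [← hYs, ← hY, hV, Matrix.mul_one]
    abel
  have hpos : ((∑ ω, ∑ k, (V ω k)ᴴ * ((Z ω)ᴴ * Z ω) * V ω k) - Yᴴ * Y).PosSemidef := by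
    rw [← hsq]
    exact Matrix.posSemidef_sum _ fun ω _ => Matrix.posSemidef_sum _ fun k _ =>
      Matrix.posSemidef_conjTranspose_mul_self _
  have h := (Complex.le_def.1 (trace_mul_nonneg hX hpos)).1
  rw [Matrix.mul_sub, Matrix.trace_sub, Complex.sub_re, Complex.zero_re, Matrix.mul_sum,
    Matrix.trace_sum, Complex.re_sum] at h
  simp only [trace_instAct_mul]
  linarith

lemma sum_re_trace_instAct (hV : ∑ ω, ∑ k, (V ω k)ᴴ * V ω k = 1)
    (X : Matrix (Fin n) (Fin n) ℂ) : ∑ ω, (instAct V ω X).trace.re = X.trace.re := by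
  have h : ∀ ω, (instAct V ω X).trace = (X * ∑ k, (V ω k)ᴴ * V ω k).trace := fun ω => by
    simpa using trace_instAct_mul V ω X 1
  simp only [h]
  rw [← Complex.re_sum, ← Matrix.trace_sum, ← Matrix.mul_sum, hV, Matrix.mul_one]

lemma sum_modularResolvent_instAct_le (hV : ∑ ω, ∑ k, (V ω k)ᴴ * V ω k = 1)
    {σ τ : Matrix (Fin n) (Fin n) ℂ} (hσ : σ.PosSemidef) (hτ : τ.PosSemidef) {R : ℝ}
    (hR : 0 < R) :
    ∑ ω, modularResolvent (instAct_posSemidef V ω hσ).1 (instAct_posSemidef V ω hτ).1 R ≤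
      modularResolvent hσ.1 hτ.1 R := by
  choose Z hZ using fun ω => exists_modularQuad_eq_modularResolvent
    (instAct_posSemidef V ω hσ) (instAct_posSemidef V ω hτ) hR
  set Y := ∑ ω, ∑ k, (V ω k)ᴴ * Z ω * V ω k with hY
  refine le_trans ?_ (modularQuad_le_modularResolvent hσ hτ hR Y)
  have hYs : Yᴴ = ∑ ω, ∑ k, (V ω k)ᴴ * (Z ω)ᴴ * V ω k := by
    simp [hY, conjTranspose_sum, Matrix.mul_assoc]
  have h1 : (Y * σ).trace.re = ∑ ω, (Z ω * instAct V ω σ).trace.re := by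
    simp only [Matrix.trace_mul_comm (Z _), trace_instAct_mul]
    rw [Matrix.trace_mul_comm, hY, Matrix.mul_sum, Matrix.trace_sum, Complex.re_sum]
  have h2 := re_trace_dual_conjTranspose_mul_le V hV hσ Z hY
  have h3 := re_trace_dual_conjTranspose_mul_le V hV hτ (fun ω => (Z ω)ᴴ) hYs
  simp only [conjTranspose_conjTranspose] at h3
  simp only [← hZ, modularQuad, Finset.sum_sub_distrib, ← Finset.mul_sum]
  rw [h1]
  have := mul_le_mul_of_nonneg_left h2 hR.le
  linarith

open Filter Topology in
/-- Monotonicity of the relative entropy under an instrument. -/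
theorem sum_relEnt_instAct_le (hV : ∑ ω, ∑ k, (V ω k)ᴴ * V ω k = 1)
    {σ τ : Matrix (Fin n) (Fin n) ℂ} (hσ : σ.PosSemidef) (hτ : τ.PosSemidef) {c : ℝ}
    (hc : 0 < c) (h : (τ - c • σ).PosSemidef) :
    ∑ ω, relEnt (instAct V ω σ) (instAct V ω τ) ≤ relEnt σ τ := by
  have hI : ∀ ω, (instAct V ω τ - c • instAct V ω σ).PosSemidef := fun ω => by
    rw [← instAct_smul, ← instAct_sub]
    exact instAct_posSemidef V ω h
  set G : ℝ → ℝ := fun R => truncRelEnt hσ.1 hτ.1 R -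
    ∑ ω, truncRelEnt (instAct_posSemidef V ω hσ).1 (instAct_posSemidef V ω hτ).1 R with hG
  have hderiv : ∀ R, 0 ≤ R → HasDerivAt G (modularResolvent hσ.1 hτ.1 R -
      ∑ ω, modularResolvent (instAct_posSemidef V ω hσ).1 (instAct_posSemidef V ω hτ).1 R) R := by
    intro R hR
    have h1 := (hasDerivAt_truncRelEnt hσ hτ hc h hR).sub
      (HasDerivAt.fun_sum (u := Finset.univ) fun ω _ => hasDerivAt_truncRelEnt
        (instAct_posSemidef V ω hσ) (instAct_posSemidef V ω hτ) hc (hI ω) hR)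
    refine h1.congr_deriv ?_
    rw [Finset.sum_sub_distrib, ← Finset.sum_div, sum_re_trace_instAct V hV]
    ring
  have hmono : MonotoneOn G (Set.Ici 0) := by
    refine monotoneOn_of_deriv_nonneg (convex_Ici 0)
      (fun R hR => (hderiv R hR).continuousAt.continuousWithinAt)
      (fun R hR => ?_) (fun R hR => ?_)
    all_goals rw [interior_Ici, Set.mem_Ioi] at hR
    · exact (hderiv R hR.le).differentiableAt.differentiableWithinAt
    · rw [(hderiv R hR.le).deriv]
      exact sub_nonneg.2 (sum_modularResolvent_instAct_le V hV hσ hτ hR)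
  have hG0 : G 0 = 0 := by simp [hG, truncRelEnt_zero]
  have hlim : Tendsto G atTop (𝓝 (relEnt σ τ -
      ∑ ω, relEnt (instAct V ω σ) (instAct V ω τ))) :=
    (tendsto_truncRelEnt hσ hτ hc h).sub (tendsto_finsetSum _ fun ω _ =>
      tendsto_truncRelEnt (instAct_posSemidef V ω hσ) (instAct_posSemidef V ω hτ) hc (hI ω))
  refine sub_nonneg.1 (ge_of_tendsto hlim ?_)
  filter_upwards [eventually_ge_atTop 0] with R hR
  rw [← hG0]
  exact hmono Set.self_mem_Ici hR hR

end Instrument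

theorem SWW_symmetric_form {A Ω K : Type*} [Fintype A] [Fintype Ω] [Fintype K]
    [Nonempty A] [Nonempty Ω] [Nonempty K] {n m : ℕ} (hn : 1 ≤ n) (hm : 1 ≤ m)
    (p : A → ℝ) (hp0 : ∀ α, 0 ≤ p α) (hp1 : ∑ α, p α = 1)
    (ρ : A → Matrix (Fin n) (Fin n) ℂ) (hρ : ∀ α, IsDensityMatrix (ρ α))
    (V : Ω → K → Matrix (Fin m) (Fin n) ℂ)
    (hV : ∑ ω, ∑ k, (V ω k)ᴴ * V ω k = 1)
    (η : Matrix (Fin n) (Fin n) ℂ) (hη : η = ∑ α, p α • ρ α)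
    (Pf : Ω → ℝ) (hPf : ∀ ω, Pf ω = probOut V η ω)
    (ηf : Matrix (Fin m) (Fin m) ℂ) (hηf : ηf = ∑ ω, instAct V ω η) :
    Ic p ρ V ≤
      holevoChi p ρ
        + (∑ ω, (if 0 < Pf ω then Pf ω * relEnt (post V ω η) ηf else 0))
        - (∑ α, ∑ ω, (if 0 < p α * probOut V (ρ α) ω then
        (p α * probOut V (ρ α) ω) * relEnt (post V ω (ρ α)) ηf
      else 0)) := by
  have hρ' : ∀ α, (ρ α).PosSemidef := fun α => (hρ α).1
  have hη' : η.PosSemidef := by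
    rw [hη]
    exact Matrix.posSemidef_sum _ fun α _ => (hρ' α).smul (hp0 α)
  have hηf' : ηf.PosSemidef := by
    rw [hηf]
    exact Matrix.posSemidef_sum _ fun ω _ => instAct_posSemidef V ω hη'
  have hq : ∀ α ω, 0 ≤ probOut V (ρ α) ω := fun α ω => probOut_nonneg V ω (hρ' α)
  have hPf_sum : ∀ ω, Pf ω = ∑ α, p α * probOut V (ρ α) ω := fun ω => by
    rw [hPf, hη, probOut_sum_smul]
  have hPf_nonneg : ∀ ω, 0 ≤ Pf ω := fun ω => by
    rw [hPf]
    exact probOut_nonneg V ω hη'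
  have hL : ∀ (ω : Ω) {τ : Matrix (Fin m) (Fin m) ℂ} (hτ : τ.IsHermitian),
      ∑ α, p α * traceMulLog hτ (instAct V ω (ρ α)) = traceMulLog hτ (instAct V ω η) := by
    intro ω τ hτ
    rw [hη, instAct_sum, ← traceMulLog_sum_smul]
    simp only [instAct_smul]
  have hchi : ∑ α, p α * ∑ ω, relEnt (instAct V ω (ρ α)) (instAct V ω η) ≤ holevoChi p ρ := by
    refine Finset.sum_le_sum fun α _ => ?_
    rw [← hη]
    split_ifs with hα
    · refine mul_le_mul_of_nonneg_left (sum_relEnt_instAct_le V hV (hρ' α) hη' hα ?_) hα.le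
      classical
      rw [hη, ← Finset.add_sum_erase _ _ (Finset.mem_univ α), add_sub_cancel_left]
      exact Matrix.posSemidef_sum _ fun β _ => (hρ' β).smul (hp0 β)
    · rw [le_antisymm (not_lt.1 hα) (hp0 α), zero_mul]
  have hic : ∀ α ω, (if 0 < p α * probOut V (ρ α) ω then
      p α * probOut V (ρ α) ω *
        Real.log ((p α * probOut V (ρ α) ω) / (p α * probOut V (∑ β, p β • ρ β) ω)) else 0) =
      -(p α * Real.negMulLog (probOut V (ρ α) ω))
        - p α * probOut V (ρ α) ω * Real.log (Pf ω) := by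
    intro α ω
    rw [← hη, ← hPf]
    split_ifs with h
    · have hle : p α * probOut V (ρ α) ω ≤ Pf ω := by
        rw [hPf_sum]
        exact Finset.single_le_sum (f := fun β => p β * probOut V (ρ β) ω)
          (fun β _ => mul_nonneg (hp0 β) (hq β ω)) (Finset.mem_univ α)
      rw [mul_div_mul_left _ _ (left_ne_zero_of_mul h.ne'),
        Real.log_div (right_ne_zero_of_mul h.ne') (h.trans_le hle).ne', Real.negMulLog]
      ring
    · have h0 := le_antisymm (not_lt.1 h) (mul_nonneg (hp0 α) (hq α ω))
      rw [Real.negMulLog]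
      linear_combination (Real.log (Pf ω) - Real.log (probOut V (ρ α) ω)) * h0
  have hcj : ∀ α ω, (if 0 < p α * probOut V (ρ α) ω then
      (p α * probOut V (ρ α) ω) * relEnt (post V ω (ρ α)) ηf else 0) =
      -(p α * (probOut V (ρ α) ω * vnEntropy (post V ω (ρ α))))
        - p α * traceMulLog hηf'.1 (instAct V ω (ρ α)) := by
    intro α ω
    have h1 : (if 0 < p α * probOut V (ρ α) ω then
        (p α * probOut V (ρ α) ω) * relEnt (post V ω (ρ α)) ηf else 0) =
        p α * (probOut V (ρ α) ω * relEnt (post V ω (ρ α)) ηf) := by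
      split_ifs with h
      · ring
      · have h0 := le_antisymm (not_lt.1 h) (mul_nonneg (hp0 α) (hq α ω))
        rw [← mul_assoc, h0, zero_mul]
    rw [h1, probOut_mul_relEnt_post V ω (hρ' α) hηf']
    ring
  have hcf : ∀ ω, (if 0 < Pf ω then Pf ω * relEnt (post V ω η) ηf else 0) =
      -(Pf ω * vnEntropy (post V ω η)) - traceMulLog hηf'.1 (instAct V ω η) := by
    intro ω
    have h1 : (if 0 < Pf ω then Pf ω * relEnt (post V ω η) ηf else 0) =
        Pf ω * relEnt (post V ω η) ηf := by
      split_ifs with h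
      · rfl
      · rw [le_antisymm (not_lt.1 h) (hPf_nonneg ω), zero_mul]
    rw [h1, hPf, probOut_mul_relEnt_post V ω hη' hηf']
  have hrel : ∀ α ω, relEnt (instAct V ω (ρ α)) (instAct V ω η) =
      -(probOut V (ρ α) ω * vnEntropy (post V ω (ρ α)) + Real.negMulLog (probOut V (ρ α) ω))
        - traceMulLog (instAct_posSemidef V ω hη').1 (instAct V ω (ρ α)) := fun α ω => by
    rw [relEnt_eq_neg_vnEntropy_sub (instAct_posSemidef V ω (hρ' α)).1
      (instAct_posSemidef V ω hη'), vnEntropy_instAct V ω (hρ' α)]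
  have hpoint : ∀ ω,
      ∑ α, p α * relEnt (instAct V ω (ρ α)) (instAct V ω η) =
      ∑ α, (-(p α * Real.negMulLog (probOut V (ρ α) ω))
        - p α * probOut V (ρ α) ω * Real.log (Pf ω)) +
      ∑ α, (-(p α * (probOut V (ρ α) ω * vnEntropy (post V ω (ρ α))))
        - p α * traceMulLog hηf'.1 (instAct V ω (ρ α))) -
      (-(Pf ω * vnEntropy (post V ω η)) - traceMulLog hηf'.1 (instAct V ω η)) := by
    intro ω
    have hH := vnEntropy_instAct V ω hη'
    rw [← hPf, Real.negMulLog] at hH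
    simp only [hrel, mul_sub, mul_neg, mul_add, Finset.sum_sub_distrib, Finset.sum_neg_distrib,
      Finset.sum_add_distrib, hL, traceMulLog_self, ← Finset.sum_mul, ← hPf_sum]
    rw [hH]
    ring
  have htotal := Finset.sum_congr (rfl : (Finset.univ : Finset Ω) = _) fun ω _ => hpoint ω
  rw [Finset.sum_sub_distrib, Finset.sum_add_distrib] at htotal
  simp only [Finset.mul_sum] at hchi
  rw [Finset.sum_comm, htotal] at hchi
  rw [Ic, Finset.sum_congr rfl fun α _ => Finset.sum_congr rfl fun ω _ => hic α ω,
    Finset.sum_congr rfl fun α _ => Finset.sum_congr rfl fun ω _ => hcj α ω,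
    Finset.sum_congr rfl fun ω _ => hcf ω, Finset.sum_comm,
    Finset.sum_comm (f := fun α ω => -(p α * (probOut V (ρ α) ω * vnEntropy (post V ω (ρ α))))
        - p α * traceMulLog hηf'.1 (instAct V ω (ρ α)))]
  linarith

end
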